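/- For every T > 0, M ≥ 1 and ε ∈ (0,1] there exists a constant C > 0, depending only on M, ε and T, such that every smooth solution (v,u,θ,q) of the radiation hydrodynamics system on [0,T] with (M,ε)-bounded initial data satisfies ‖u(t,·)‖² + ∫₀ᵗ ∫_𝕋 u_x(s,x)²/v(s,x) dx ds ≤ C(1 + 𝔜(t)^{1/(2β+3)}) for all t ∈ [0,T]. -/

import Mathlib

open MeasureTheory Real Set

noncomputable section

namespace RadHydro

/-- Integral over one period `[-1/2, 1/2]` of the torus `𝕋 ≅ ℝ/ℤ`. -/
def tInt (f : ℝ → ℝ) : ℝ := ∫ x in (-(1/2) : ℝ)..(1/2 : ℝ), f x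

/-- Squared `L²` norm over the torus. -/
def L2sq (f : ℝ → ℝ) : ℝ := tInt fun x => (f x) ^ 2

/-- `L^∞` norm over the torus. -/
def Linf (f : ℝ → ℝ) : ℝ := sSup ((fun x => |f x|) '' Icc (-(1/2) : ℝ) (1/2))

/-- Squared `H¹` norm over the torus. -/
def H1sq (f : ℝ → ℝ) : ℝ := L2sq f + L2sq (deriv f)

/-- Squared `H²` norm over the torus. -/
def H2sq (f : ℝ → ℝ) : ℝ := L2sq f + L2sq (deriv f) + L2sq (deriv (deriv f))

/-- Partial derivative in the time variable. -/
def pt (f : ℝ → ℝ → ℝ) (t x : ℝ) : ℝ := deriv (fun s => f s x) t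

/-- Partial derivative in the space variable. -/
def px (f : ℝ → ℝ → ℝ) (t x : ℝ) : ℝ := deriv (f t) x

/-- The heat conductivity `κ(v, θ) = κ₁ + κ₂ v θ^β`. -/
def kappa (κ₁ κ₂ β v θ : ℝ) : ℝ := κ₁ + κ₂ * v * θ ^ β

/-- A smooth solution of the radiation hydrodynamics system (in Lagrangian
coordinates) on `[0, T]`: four `C^∞` functions on `[0,T] × ℝ` (modelled as smooth
functions on all of `ℝ × ℝ`), `1`-periodic in the space variable, with `v > 0`,
`θ > 0`, satisfying the four equations pointwise for `t ∈ [0, T]`, and with the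
normalization `∫_𝕋 v(0, x) dx = 1`. -/
structure Sol (μ R a b κ₁ κ₂ β γ T : ℝ) where
  v : ℝ → ℝ → ℝ
  u : ℝ → ℝ → ℝ
  θ : ℝ → ℝ → ℝ
  q : ℝ → ℝ → ℝ
  smooth_v : ContDiff ℝ (⊤ : ℕ∞) fun p : ℝ × ℝ => v p.1 p.2
  smooth_u : ContDiff ℝ (⊤ : ℕ∞) fun p : ℝ × ℝ => u p.1 p.2
  smooth_θ : ContDiff ℝ (⊤ : ℕ∞) fun p : ℝ × ℝ => θ p.1 p.2
  smooth_q : ContDiff ℝ (⊤ : ℕ∞) fun p : ℝ × ℝ => q p.1 p.2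
  periodic_v : ∀ t, Function.Periodic (v t) 1
  periodic_u : ∀ t, Function.Periodic (u t) 1
  periodic_θ : ∀ t, Function.Periodic (θ t) 1
  periodic_q : ∀ t, Function.Periodic (q t) 1
  v_pos : ∀ t x, 0 < v t x
  θ_pos : ∀ t x, 0 < θ t x
  eq_mass : ∀ t ∈ Icc (0 : ℝ) T, ∀ x : ℝ, pt v t x - px u t x = 0
  eq_mom : ∀ t ∈ Icc (0 : ℝ) T, ∀ x : ℝ,
    pt u t x + px (fun s y => R * θ s y / v s y) t x
      = px (fun s y => μ * px u s y / v s y) t x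
  eq_energy : ∀ t ∈ Icc (0 : ℝ) T, ∀ x : ℝ,
    pt (fun s y => R / (γ - 1) * θ s y + (u s y) ^ 2 / 2) t x
      + px (fun s y => R * θ s y / v s y * u s y) t x + px q t x
      = px (fun s y => μ * u s y * px u s y / v s y) t x
        + px (fun s y => kappa κ₁ κ₂ β (v s y) (θ s y) * px θ s y / v s y) t x
  eq_rad : ∀ t ∈ Icc (0 : ℝ) T, ∀ x : ℝ,
    -px (fun s y => px q s y / v s y) t x + a * v t x * q t x
      + b * px (fun s y => (θ s y) ^ 4) t x = 0
  mean_v : tInt (v 0) = 1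

/-- `(M, ε)`-bounded initial data: `‖(v₀, u₀, θ₀)‖_{H²} ≤ M` and `v₀ ≥ ε`, `θ₀ ≥ ε`. -/
def DataBounded (M ε : ℝ) (v₀ u₀ θ₀ : ℝ → ℝ) : Prop :=
  Real.sqrt (H2sq v₀ + H2sq u₀ + H2sq θ₀) ≤ M ∧ (∀ x, ε ≤ v₀ x) ∧ ∀ x, ε ≤ θ₀ x

variable {μ R a b κ₁ κ₂ β γ T : ℝ}

/-- A solution has `(M, ε)`-bounded initial data. -/
def Sol.Bounded (S : Sol μ R a b κ₁ κ₂ β γ T) (M ε : ℝ) : Prop :=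
  DataBounded M ε (S.v 0) (S.u 0) (S.θ 0)

/-- The auxiliary function `𝔛(t) = ∫₀ᵗ ∫_𝕋 κ(v,θ) θ_t² / v dx ds`. -/
def Sol.X (S : Sol μ R a b κ₁ κ₂ β γ T) (t : ℝ) : ℝ :=
  ∫ s in (0 : ℝ)..t, tInt fun x =>
    kappa κ₁ κ₂ β (S.v s x) (S.θ s x) * (pt S.θ s x) ^ 2 / S.v s x

/-- The auxiliary function `𝔜(t) = max_{0 ≤ s ≤ t} ∫_𝕋 κ(v,θ)² θ_x² / v² dx`. -/
def Sol.Y (S : Sol μ R a b κ₁ κ₂ β γ T) (t : ℝ) : ℝ :=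
  sSup ((fun s => tInt fun x =>
    (kappa κ₁ κ₂ β (S.v s x) (S.θ s x)) ^ 2 * (px S.θ s x) ^ 2 / (S.v s x) ^ 2) ''
      Icc (0 : ℝ) t)

/-- The auxiliary function `ℨ(t) = max_{0 ≤ s ≤ t} ∫_𝕋 u_{xx}² / v² dx`. -/
def Sol.Z (S : Sol μ R a b κ₁ κ₂ β γ T) (t : ℝ) : ℝ :=
  sSup ((fun s => tInt fun x => (px (px S.u) s x) ^ 2 / (S.v s x) ^ 2) '' Icc (0 : ℝ) t)

/-- The exponent `𝔗₀(n, p, β)`. -/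
def T0 (n _p β : ℝ) : ℝ :=
  if n < (β + 3) / 2 then 4 / (n * (2 * β + 3)) else (n - β + 5) / (n * (2 * β + 3))

/-- The exponent `𝔗₁(n, β)`. -/
def T1 (n β : ℝ) : ℝ := max (T0 n 8 β) (1 / (2 * β + 3) + T0 n 1 β)

/-- The exponent `𝔘ʸ₁₁(n, β)`. -/
def Uy11 (n β : ℝ) : ℝ := 2 / (2 * β + 3) + T0 n 1 β

/-- The exponent `𝔘ᶻ₁₁(n, β)`. -/
def Uz11 (n β : ℝ) : ℝ := 3 / 4 * (1 / (1 - T0 n (5/2) β))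

/-- The exponent `𝔘ʸ₂(n, β)`. -/
def Uy2 (n β : ℝ) : ℝ := 2 / (2 * β + 3) + T1 n β

/-- The exponent `𝔘ᶻ₂(n, β)`. -/
def Uz2 (n β : ℝ) : ℝ := 3 / 4 * (1 / (1 - T0 n (3/2) β - T1 n β))

end RadHydro

open RadHydro

namespace RadHydro

/-! ### Calculus on the strip -/

/-- Joint smoothness of a function of time and space. -/
abbrev JointSmooth (f : ℝ → ℝ → ℝ) : Prop :=
  ContDiff ℝ (⊤ : ℕ∞) fun p : ℝ × ℝ => f p.1 p.2

lemma JointSmooth.hasDerivAt_time {f : ℝ → ℝ → ℝ} (hf : JointSmooth f) (t x : ℝ) :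
    HasDerivAt (fun s => f s x) (pt f t x) t := by
  have h : ContDiff ℝ (⊤ : ℕ∞) fun s : ℝ => f s x :=
    hf.comp (contDiff_id.prodMk contDiff_const)
  exact (h.differentiable (by simp) t).hasDerivAt

lemma JointSmooth.hasDerivAt_space {f : ℝ → ℝ → ℝ} (hf : JointSmooth f) (t x : ℝ) :
    HasDerivAt (f t) (px f t x) x := by
  have h : ContDiff ℝ (⊤ : ℕ∞) fun y : ℝ => f t y :=
    hf.comp (contDiff_const.prodMk contDiff_id)
  exact (h.differentiable (by simp) x).hasDerivAt

lemma JointSmooth.px {f : ℝ → ℝ → ℝ} (hf : JointSmooth f) : JointSmooth (px f) := by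
  have e : (fun p : ℝ × ℝ => RadHydro.px f p.1 p.2) = fun p : ℝ × ℝ =>
      fderiv ℝ (fun p : ℝ × ℝ => f p.1 p.2) p ((0 : ℝ), (1 : ℝ)) := by
    funext p
    have h := (hf.differentiable (by simp) (p.1, p.2)).hasFDerivAt.comp_hasDerivAt p.2
      ((hasDerivAt_const p.2 p.1).prodMk (hasDerivAt_id p.2))
    exact (hf.hasDerivAt_space p.1 p.2).unique h
  rw [JointSmooth, e]
  exact (hf.fderiv_right (by simp)).clm_apply contDiff_const

lemma JointSmooth.pt {f : ℝ → ℝ → ℝ} (hf : JointSmooth f) : JointSmooth (pt f) := by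
  have e : (fun p : ℝ × ℝ => RadHydro.pt f p.1 p.2) = fun p : ℝ × ℝ =>
      fderiv ℝ (fun p : ℝ × ℝ => f p.1 p.2) p ((1 : ℝ), (0 : ℝ)) := by
    funext p
    have h := (hf.differentiable (by simp) (p.1, p.2)).hasFDerivAt.comp_hasDerivAt p.1
      ((hasDerivAt_id p.1).prodMk (hasDerivAt_const p.1 p.2))
    exact (hf.hasDerivAt_time p.1 p.2).unique h
  rw [JointSmooth, e]
  exact (hf.fderiv_right (by simp)).clm_apply contDiff_const

lemma continuous_slice {f : ℝ → ℝ → ℝ} (hf : Continuous fun p : ℝ × ℝ => f p.1 p.2) (t : ℝ) :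
    Continuous (f t) :=
  hf.comp (continuous_const.prodMk continuous_id)

/-- Differentiation under the integral sign. -/
lemma hasDerivAt_integral_param {f f' : ℝ → ℝ → ℝ}
    (hf : Continuous fun p : ℝ × ℝ => f p.1 p.2)
    (hf' : Continuous fun p : ℝ × ℝ => f' p.1 p.2)
    (h : ∀ t x, HasDerivAt (fun s => f s x) (f' t x) t) (a b t : ℝ) :
    HasDerivAt (fun s => ∫ x in a..b, f s x) (∫ x in a..b, f' t x) t := by
  obtain ⟨K, hK⟩ := ((isCompact_Icc (a := t - 1) (b := t + 1)).prod
    (isCompact_uIcc (a := a) (b := b))).exists_bound_of_continuousOn hf'.continuousOn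
  refine (intervalIntegral.hasDerivAt_integral_of_dominated_loc_of_deriv_le
    (bound := fun _ => K) (s := Icc (t - 1) (t + 1))
    (Icc_mem_nhds (by linarith) (by linarith)) ?_ ?_ ?_ ?_ ?_ ?_).2
  · exact Filter.Eventually.of_forall fun s => (continuous_slice hf s).aestronglyMeasurable
  · exact (continuous_slice hf t).intervalIntegrable _ _
  · exact (continuous_slice hf' t).aestronglyMeasurable
  · exact Filter.Eventually.of_forall fun x hx s hs =>
      hK (s, x) ⟨hs, uIoc_subset_uIcc hx⟩
  · exact intervalIntegrable_const
  · exact Filter.Eventually.of_forall fun x _ s _ => h s x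

lemma JointSmooth.hasDerivAt_tInt {f : ℝ → ℝ → ℝ} (hf : JointSmooth f) (t : ℝ) :
    HasDerivAt (fun s => tInt (f s)) (tInt (RadHydro.pt f t)) t :=
  hasDerivAt_integral_param hf.continuous hf.pt.continuous hf.hasDerivAt_time _ _ t

/-! ### Integrals over one period -/

lemma tInt_mono {f g : ℝ → ℝ} (hf : Continuous f) (hg : Continuous g)
    (h : ∀ x ∈ Icc (-(1/2) : ℝ) (1/2), f x ≤ g x) : tInt f ≤ tInt g :=
  intervalIntegral.integral_mono_on (by norm_num) (hf.intervalIntegrable _ _)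
    (hg.intervalIntegrable _ _) h

lemma tInt_const (c : ℝ) : tInt (fun _ => c) = c := by
  simp [tInt]; ring

lemma tInt_add {f g : ℝ → ℝ} (hf : Continuous f) (hg : Continuous g) :
    tInt (fun x => f x + g x) = tInt f + tInt g :=
  intervalIntegral.integral_add (hf.intervalIntegrable _ _) (hg.intervalIntegrable _ _)

lemma tInt_sub {f g : ℝ → ℝ} (hf : Continuous f) (hg : Continuous g) :
    tInt (fun x => f x - g x) = tInt f - tInt g :=
  intervalIntegral.integral_sub (hf.intervalIntegrable _ _) (hg.intervalIntegrable _ _)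

lemma tInt_add_sub_add {f g h k : ℝ → ℝ} (hf : Continuous f) (hg : Continuous g)
    (hh : Continuous h) (hk : Continuous k) :
    tInt (fun x => f x + g x - (h x + k x)) = tInt f + tInt g - (tInt h + tInt k) := by
  rw [tInt_sub (f := fun x => f x + g x) (g := fun x => h x + k x) (hf.add hg) (hh.add hk),
    tInt_add hf hg, tInt_add hh hk]

lemma tInt_const_mul (c : ℝ) (f : ℝ → ℝ) : tInt (fun x => c * f x) = c * tInt f :=
  intervalIntegral.integral_const_mul c f

lemma tInt_linear_combination {f g : ℝ → ℝ} (hf : Continuous f) (hg : Continuous g) (c d : ℝ) :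
    tInt (fun x => c * f x + d * g x) = c * tInt f + d * tInt g := by
  rw [tInt_add (f := fun x => c * f x) (g := fun x => d * g x) (continuous_const.mul hf)
    (continuous_const.mul hg), tInt_const_mul, tInt_const_mul]

lemma tInt_nonneg {f : ℝ → ℝ} (h : ∀ x, 0 ≤ f x) : 0 ≤ tInt f :=
  intervalIntegral.integral_nonneg (by norm_num) fun x _ => h x

lemma JointSmooth.tInt_px_eq_zero {f : ℝ → ℝ → ℝ} (hf : JointSmooth f) {t : ℝ}
    (hp : Function.Periodic (f t) 1) : tInt (RadHydro.px f t) = 0 := by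
  have h := intervalIntegral.integral_eq_sub_of_hasDerivAt
    (fun x _ => hf.hasDerivAt_space t x)
    ((continuous_slice hf.px.continuous t).intervalIntegrable (-(1/2)) (1/2))
  rw [tInt, h]
  have := hp (-(1/2))
  norm_num at this ⊢
  linarith

lemma exists_le_tInt {f : ℝ → ℝ} (hf : Continuous f) :
    ∃ y ∈ Icc (-(1/2) : ℝ) (1/2), f y ≤ tInt f := by
  obtain ⟨y, hy, hmin⟩ := (isCompact_Icc (a := (-(1/2) : ℝ)) (b := 1/2)).exists_isMinOn
    (nonempty_Icc.2 (by norm_num)) hf.continuousOn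
  refine ⟨y, hy, ?_⟩
  rw [← tInt_const (f y)]
  exact tInt_mono continuous_const hf fun x hx => hmin hx

lemma abs_integral_le_tInt_abs {f : ℝ → ℝ} (hf : Continuous f) {x y : ℝ}
    (hx : x ∈ Icc (-(1/2) : ℝ) (1/2)) (hy : y ∈ Icc (-(1/2) : ℝ) (1/2)) :
    |∫ z in y..x, f z| ≤ tInt fun z => |f z| := by
  have key : ∀ {c d : ℝ}, c ≤ d → -(1/2) ≤ c → d ≤ 1/2 →
      |∫ z in c..d, f z| ≤ tInt fun z => |f z| := fun hcd hc hd =>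
    (intervalIntegral.abs_integral_le_integral_abs hcd).trans
      (intervalIntegral.integral_mono_interval hc hcd hd
        (Filter.Eventually.of_forall fun z => abs_nonneg (f z))
        (hf.abs.intervalIntegrable _ _))
  rcases le_total y x with h | h
  · exact key h hy.1 hx.2
  · rw [intervalIntegral.integral_symm, abs_neg]
    exact key h hx.1 hy.2

lemma sub_le_tInt_abs_deriv {f f' : ℝ → ℝ} (h : ∀ x, HasDerivAt f (f' x) x)
    (hf' : Continuous f') {x y : ℝ}
    (hx : x ∈ Icc (-(1/2) : ℝ) (1/2)) (hy : y ∈ Icc (-(1/2) : ℝ) (1/2)) :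
    f x - f y ≤ tInt fun z => |f' z| := by
  rw [← intervalIntegral.integral_eq_sub_of_hasDerivAt (fun z _ => h z)
    (hf'.intervalIntegrable _ _)]
  exact (le_abs_self _).trans (abs_integral_le_tInt_abs hf' hx hy)

lemma tInt_abs_le_one_add_L2sq {f : ℝ → ℝ} (hf : Continuous f) :
    tInt (fun x => |f x|) ≤ 1 + L2sq f := by
  have h := tInt_add (f := fun _ => 1) (g := fun x => f x ^ 2) continuous_const (by fun_prop)
  rw [tInt_const] at h
  rw [L2sq, ← h]
  exact tInt_mono hf.abs (by fun_prop) fun x _ => by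
    nlinarith [sq_nonneg (|f x| - 1), sq_abs (f x), abs_nonneg (f x)]

end RadHydro

namespace RadHydro

lemma le_initial_of_hasDerivAt_nonpos {f f' : ℝ → ℝ} {T : ℝ}
    (h : ∀ t ∈ Icc (0 : ℝ) T, HasDerivAt f (f' t) t)
    (hn : ∀ t ∈ Icc (0 : ℝ) T, f' t ≤ 0) {t : ℝ} (ht : t ∈ Icc (0 : ℝ) T) : f t ≤ f 0 := by
  refine antitoneOn_of_deriv_nonpos (convex_Icc 0 T)
    (fun s hs => (h s hs).continuousAt.continuousWithinAt)
    (fun s hs => (h s (interior_subset hs)).differentiableAt.differentiableWithinAt)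
    (fun s hs => ?_) ⟨le_rfl, ht.1.trans ht.2⟩ ht ht.1
  rw [(h s (interior_subset hs)).deriv]
  exact hn s (interior_subset hs)

lemma eq_initial_of_hasDerivAt_zero {f f' : ℝ → ℝ} {T : ℝ}
    (h : ∀ t ∈ Icc (0 : ℝ) T, HasDerivAt f (f' t) t)
    (hz : ∀ t ∈ Icc (0 : ℝ) T, f' t = 0) {t : ℝ} (ht : t ∈ Icc (0 : ℝ) T) : f t = f 0 := by
  refine le_antisymm (le_initial_of_hasDerivAt_nonpos h (fun s hs => (hz s hs).le) ht) ?_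
  have := le_initial_of_hasDerivAt_nonpos (f := fun s => -f s) (fun s hs => (h s hs).neg)
    (fun s hs => by simp [hz s hs]) ht
  linarith

lemma periodic_px {f : ℝ → ℝ → ℝ} {t : ℝ} (hf : Function.Periodic (f t) 1) :
    Function.Periodic (px f t) 1 := by
  intro x
  have h : (fun y => f t (y + 1)) = f t := funext hf
  have h2 := deriv_comp_add_const (f t) 1 x
  rw [h] at h2
  exact h2.symm

namespace Sol

variable {μ R a b κ₁ κ₂ β γ T : ℝ} (S : Sol μ R a b κ₁ κ₂ β γ T)

/-- The pressure `P = R θ / v`. -/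
abbrev pressure (s y : ℝ) : ℝ := R * S.θ s y / S.v s y

/-- The viscous stress `μ u_x / v`. -/
abbrev viscous (s y : ℝ) : ℝ := μ * px S.u s y / S.v s y

lemma jointSmooth_pressure : JointSmooth S.pressure :=
  (contDiff_const.mul S.smooth_θ).div S.smooth_v fun p => (S.v_pos p.1 p.2).ne'

lemma jointSmooth_viscous : JointSmooth S.viscous :=
  (contDiff_const.mul (JointSmooth.px S.smooth_u)).div S.smooth_v
    fun p => (S.v_pos p.1 p.2).ne'

lemma jointSmooth_kappa :
    JointSmooth fun s y => kappa κ₁ κ₂ β (S.v s y) (S.θ s y) :=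
  contDiff_const.add ((contDiff_const.mul S.smooth_v).mul
    (S.smooth_θ.rpow_const_of_ne fun p => (S.θ_pos p.1 p.2).ne'))

lemma periodic_pressure (t : ℝ) : Function.Periodic (S.pressure t) 1 := fun x => by
  simp only [pressure, S.periodic_θ t x, S.periodic_v t x]

lemma periodic_viscous (t : ℝ) : Function.Periodic (S.viscous t) 1 := fun x => by
  simp only [viscous, periodic_px (S.periodic_u t) x, S.periodic_v t x]

/-- Conservation of volume. -/
lemma tInt_v {t : ℝ} (ht : t ∈ Icc (0 : ℝ) T) : tInt (S.v t) = 1 := by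
  rw [← S.mean_v]
  refine eq_initial_of_hasDerivAt_zero (f := fun s => tInt (S.v s))
    (fun s _ => JointSmooth.hasDerivAt_tInt S.smooth_v s) (fun s hs => ?_) ht
  have h : pt S.v s = px S.u s := funext fun x => sub_eq_zero.1 (S.eq_mass s hs x)
  rw [h, JointSmooth.tInt_px_eq_zero S.smooth_u (S.periodic_u s)]

/-- Conservation of the total energy. -/
lemma tInt_energy {t : ℝ} (ht : t ∈ Icc (0 : ℝ) T) :
    tInt (fun x => R / (γ - 1) * S.θ t x + (S.u t x) ^ 2 / 2)
      = tInt fun x => R / (γ - 1) * S.θ 0 x + (S.u 0 x) ^ 2 / 2 := by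
  have hE : JointSmooth fun s y => R / (γ - 1) * S.θ s y + (S.u s y) ^ 2 / 2 :=
    (contDiff_const.mul S.smooth_θ).add ((S.smooth_u.pow 2).div_const 2)
  have h1 : JointSmooth fun s y => R * S.θ s y / S.v s y * S.u s y :=
    S.jointSmooth_pressure.mul S.smooth_u
  have h2 : JointSmooth fun s y => μ * S.u s y * px S.u s y / S.v s y :=
    ((contDiff_const.mul S.smooth_u).mul (JointSmooth.px S.smooth_u)).div S.smooth_v
      fun p => (S.v_pos p.1 p.2).ne'
  have h3 : JointSmooth fun s y =>
      kappa κ₁ κ₂ β (S.v s y) (S.θ s y) * px S.θ s y / S.v s y :=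
    (S.jointSmooth_kappa.mul (JointSmooth.px S.smooth_θ)).div S.smooth_v
      fun p => (S.v_pos p.1 p.2).ne'
  have hq : JointSmooth S.q := S.smooth_q
  refine eq_initial_of_hasDerivAt_zero
    (f := fun s => tInt (fun x => R / (γ - 1) * S.θ s x + (S.u s x) ^ 2 / 2))
    (fun s _ => hE.hasDerivAt_tInt s) (fun s hs => ?_) ht
  have c1 := continuous_slice h1.px.continuous s
  have c2 := continuous_slice h2.px.continuous s
  have c3 := continuous_slice h3.px.continuous s
  have cq := continuous_slice hq.px.continuous s
  have h : pt (fun s y => R / (γ - 1) * S.θ s y + (S.u s y) ^ 2 / 2) s = fun x =>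
      (px (fun s y => μ * S.u s y * px S.u s y / S.v s y) s x
        + px (fun s y => kappa κ₁ κ₂ β (S.v s y) (S.θ s y) * px S.θ s y / S.v s y) s x)
      - (px (fun s y => R * S.θ s y / S.v s y * S.u s y) s x + px S.q s x) := by
    funext x
    linarith [S.eq_energy s hs x]
  rw [h, tInt_add_sub_add c2 c3 c1 cq,
    h1.tInt_px_eq_zero, h2.tInt_px_eq_zero, h3.tInt_px_eq_zero,
    hq.tInt_px_eq_zero (S.periodic_q s)]
  · ring
  all_goals
    intro x
    simp only [S.periodic_θ s x, S.periodic_v s x, S.periodic_u s x,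
      periodic_px (S.periodic_u s) x, periodic_px (S.periodic_θ s) x]

/-- The time integral of the pressure at a fixed particle. -/
def impulse (t x : ℝ) : ℝ := ∫ s in (0 : ℝ)..t, S.pressure s x

lemma continuous_impulse : Continuous fun p : ℝ × ℝ => S.impulse p.1 p.2 := by
  refine intervalIntegral.continuous_parametric_intervalIntegral_of_continuous
    (f := fun (p : ℝ × ℝ) s => S.pressure s p.2) ?_ continuous_fst
  exact S.jointSmooth_pressure.continuous.comp
    (continuous_snd.prodMk (continuous_snd.comp continuous_fst))

lemma hasDerivAt_impulse (t x : ℝ) :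
    HasDerivAt (fun s => S.impulse s x) (S.pressure t x) t := by
  have hc : Continuous fun s => S.pressure s x :=
    S.jointSmooth_pressure.continuous.comp (continuous_id.prodMk continuous_const)
  exact (hc.integral_hasStrictDerivAt 0 t).hasDerivAt

lemma impulse_nonneg (hR : 0 < R) {t : ℝ} (ht : 0 ≤ t) (x : ℝ) : 0 ≤ S.impulse t x :=
  intervalIntegral.integral_nonneg ht fun s _ =>
    div_nonneg (mul_nonneg hR.le (S.θ_pos s x).le) (S.v_pos s x).le

/-- The momentum equation integrated in space and time between two particles. -/
lemma log_v_sub_log_v {t : ℝ} (ht : t ∈ Icc (0 : ℝ) T) (x y : ℝ) :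
    (μ * log (S.v t x) - S.impulse t x) - (μ * log (S.v t y) - S.impulse t y)
      = (∫ z in y..x, S.u t z) - (∫ z in y..x, S.u 0 z)
        + μ * (log (S.v 0 x) - log (S.v 0 y)) := by
  have hu : JointSmooth S.u := S.smooth_u
  have hlog : ∀ s z, HasDerivAt (fun r => log (S.v r z)) (pt S.v s z / S.v s z) s := fun s z =>
    (JointSmooth.hasDerivAt_time S.smooth_v s z).log (S.v_pos s z).ne'
  have hder : ∀ s ∈ Icc (0 : ℝ) T, HasDerivAt
      (fun s => (∫ z in y..x, S.u s z)
        - ((μ * log (S.v s x) - S.impulse s x) - (μ * log (S.v s y) - S.impulse s y)))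
      ((∫ z in y..x, pt S.u s z)
        - ((μ * (pt S.v s x / S.v s x) - S.pressure s x)
          - (μ * (pt S.v s y / S.v s y) - S.pressure s y))) s := fun s _ =>
    (hasDerivAt_integral_param hu.continuous hu.pt.continuous hu.hasDerivAt_time y x s).sub
      ((((hlog s x).const_mul μ).sub (S.hasDerivAt_impulse s x)).sub
        (((hlog s y).const_mul μ).sub (S.hasDerivAt_impulse s y)))
  have h := eq_initial_of_hasDerivAt_zero hder (fun s hs => ?_) ht
  · simp only [impulse, intervalIntegral.integral_same] at h ⊢
    linarith
  · have e : ∀ z, pt S.u s z = px S.viscous s z - px S.pressure s z := fun z => by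
      have := S.eq_mom s hs z
      linarith
    have hi : (∫ z in y..x, pt S.u s z)
        = (S.viscous s x - S.pressure s x) - (S.viscous s y - S.pressure s y) := by
      refine intervalIntegral.integral_eq_sub_of_hasDerivAt
        (f := fun z => S.viscous s z - S.pressure s z) (fun z _ => ?_)
        ((continuous_slice hu.pt.continuous s).intervalIntegrable _ _)
      rw [e z]
      exact (S.jointSmooth_viscous.hasDerivAt_space s z).sub
        (S.jointSmooth_pressure.hasDerivAt_space s z)
    have hm : ∀ z, pt S.v s z = px S.u s z := fun z => sub_eq_zero.1 (S.eq_mass s hs z)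
    rw [hi, hm x, hm y]
    simp only [viscous]
    ring

/-- The quantities `v exp(-∫P/μ)` at two particles are comparable. -/
lemma v_mul_exp_impulse_le (hμ : 0 < μ) {ε N U : ℝ} (hε : 0 < ε)
    (hv₀ : ∀ x, ε ≤ S.v 0 x) (hN : ∀ x ∈ Icc (-(1/2) : ℝ) (1/2), S.v 0 x ≤ N)
    (hU : ∀ t ∈ Icc (0 : ℝ) T, tInt (fun x => |S.u t x|) ≤ U)
    {t : ℝ} (ht : t ∈ Icc (0 : ℝ) T) {x y : ℝ}
    (hx : x ∈ Icc (-(1/2) : ℝ) (1/2)) (hy : y ∈ Icc (-(1/2) : ℝ) (1/2)) :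
    S.v t x * exp (S.impulse t y / μ)
      ≤ exp (2 * U / μ) * (N / ε) * (S.v t y * exp (S.impulse t x / μ)) := by
  have hN0 : 0 < N := (S.v_pos 0 x).trans_le (hN x hx)
  have hc : ∀ s, Continuous (S.u s) := continuous_slice S.smooth_u.continuous
  have h0 : (0 : ℝ) ∈ Icc 0 T := ⟨le_rfl, ht.1.trans ht.2⟩
  have h1 := (abs_integral_le_tInt_abs (hc t) hx hy).trans (hU t ht)
  have h2 := (abs_integral_le_tInt_abs (hc 0) hx hy).trans (hU 0 h0)
  have h3 : log (S.v 0 x) - log (S.v 0 y) ≤ log (N / ε) := by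
    rw [log_div hN0.ne' hε.ne']
    exact sub_le_sub (log_le_log (S.v_pos 0 x) (hN x hx)) (log_le_log hε (hv₀ y))
  have h4 := S.log_v_sub_log_v ht x y
  have h5 : μ * (log (S.v t x) + S.impulse t y / μ)
      ≤ μ * (2 * U / μ + log (N / ε) + (log (S.v t y) + S.impulse t x / μ)) := by
    have e1 : ∀ w, μ * (w / μ) = w := fun w => mul_div_cancel₀ w hμ.ne'
    simp only [mul_add, e1]
    nlinarith [abs_le.1 h1, abs_le.1 h2, mul_le_mul_of_nonneg_left h3 hμ.le]
  have h6 := exp_le_exp.2 (le_of_mul_le_mul_left h5 hμ)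
  simpa only [exp_add, exp_log (S.v_pos _ _), exp_log (div_pos hN0 hε)] using h6

/-- Kazhikhov's lower bound for the specific volume. -/
lemma le_v (hμ : 0 < μ) (hR : 0 < R) {D K : ℝ} (hD : 0 < D)
    (hDv : ∀ t ∈ Icc (0 : ℝ) T, ∀ x ∈ Icc (-(1/2) : ℝ) (1/2), ∀ y ∈ Icc (-(1/2) : ℝ) (1/2),
      S.v t x * exp (S.impulse t y / μ) ≤ D * (S.v t y * exp (S.impulse t x / μ)))
    (hK : ∀ t ∈ Icc (0 : ℝ) T, tInt (S.θ t) ≤ K)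
    {t : ℝ} (ht : t ∈ Icc (0 : ℝ) T) {y : ℝ} (hy : y ∈ Icc (-(1/2) : ℝ) (1/2)) :
    1 ≤ D * exp (R / μ * D * K * T) * S.v t y := by
  have cv : ∀ s, Continuous (S.v s) := continuous_slice S.smooth_v.continuous
  have cθ : ∀ s, Continuous (S.θ s) := continuous_slice S.smooth_θ.continuous
  have cF : Continuous fun p : ℝ × ℝ => exp (S.impulse p.1 p.2 / μ) :=
    (S.continuous_impulse.div_const μ).rexp
  have cF' : Continuous fun p : ℝ × ℝ =>
      exp (S.impulse p.1 p.2 / μ) * (S.pressure p.1 p.2 / μ) :=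
    cF.mul (S.jointSmooth_pressure.continuous.div_const μ)
  have cFs : ∀ s, Continuous fun x => exp (S.impulse s x / μ) := fun s =>
    cF.comp (continuous_const.prodMk continuous_id)
  have cFs' : ∀ s, Continuous fun x => exp (S.impulse s x / μ) * (S.pressure s x / μ) :=
    fun s => cF'.comp (continuous_const.prodMk continuous_id)
  have hFder : ∀ s x, HasDerivAt (fun s => exp (S.impulse s x / μ))
      (exp (S.impulse s x / μ) * (S.pressure s x / μ)) s := fun s x =>
    ((S.hasDerivAt_impulse s x).div_const μ).exp
  set G : ℝ → ℝ := fun s => tInt fun x => exp (S.impulse s x / μ) with hG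
  set G' : ℝ → ℝ := fun s => tInt fun x => exp (S.impulse s x / μ) * (S.pressure s x / μ)
    with hG'
  have hGder : ∀ s, HasDerivAt G (G' s) s := fun s =>
    hasDerivAt_integral_param cF cF' hFder _ _ s
  have hGpos : ∀ s, 0 ≤ G s := fun s => tInt_nonneg fun x => (exp_pos _).le
  have hFG : ∀ s ∈ Icc (0 : ℝ) T, ∀ y ∈ Icc (-(1/2) : ℝ) (1/2),
      exp (S.impulse s y / μ) ≤ D * S.v s y * G s := fun s hs y hy => by
    have h := tInt_mono (f := fun x => exp (S.impulse s y / μ) * S.v s x)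
      (g := fun x => (D * S.v s y) * exp (S.impulse s x / μ))
      (continuous_const.mul (cv s)) (continuous_const.mul (cFs s))
      fun x hx => by linarith [hDv s hs x hx y hy]
    rwa [tInt_const_mul, tInt_const_mul, S.tInt_v hs, mul_one] at h
  have hG'le : ∀ s ∈ Icc (0 : ℝ) T, G' s ≤ R / μ * D * K * G s := fun s hs => by
    have h := tInt_mono (f := fun x => exp (S.impulse s x / μ) * (S.pressure s x / μ))
      (g := fun x => (R / μ * D * G s) * S.θ s x)
      (cFs' s) (continuous_const.mul (cθ s)) fun x hx => by
        have hv := S.v_pos s x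
        calc exp (S.impulse s x / μ) * (S.pressure s x / μ)
            ≤ D * S.v s x * G s * (S.pressure s x / μ) := by
              refine mul_le_mul_of_nonneg_right (hFG s hs x hx) ?_
              have := S.θ_pos s x
              positivity
          _ = R / μ * D * G s * S.θ s x := by
              simp only [pressure]
              field_simp
    rw [tInt_const_mul] at h
    refine h.trans ?_
    have : 0 ≤ R / μ * D * G s := mul_nonneg (by positivity) (hGpos s)
    nlinarith [mul_le_mul_of_nonneg_left (hK s hs) this]
  set c : ℝ := R / μ * D * K with hc
  have hexp : ∀ s : ℝ, HasDerivAt (fun s => exp (-(c * s))) (exp (-(c * s)) * (-(c * 1))) s :=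
    fun s => ((hasDerivAt_id s).const_mul c).neg.exp
  have hdecay := le_initial_of_hasDerivAt_nonpos
    (fun s (_ : s ∈ Icc (0 : ℝ) T) => (hGder s).mul (hexp s)) (fun s hs => by
      have := mul_le_mul_of_nonneg_right (hG'le s hs) (exp_pos (-(c * s))).le
      simp only [mul_one]
      nlinarith) ht
  have hG0 : G 0 = 1 := by
    simp only [hG, impulse, intervalIntegral.integral_same, zero_div, exp_zero, tInt_const]
  have hK0 : 0 ≤ K := (tInt_nonneg fun x => (S.θ_pos t x).le).trans (hK t ht)
  have hc0 : 0 ≤ c := by positivity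
  have hGT : G t ≤ exp (c * T) := by
    have h1 : G t * exp (-(c * t)) ≤ 1 := by
      simpa [hG0] using hdecay
    rw [exp_neg, ← div_eq_mul_inv, div_le_one (exp_pos _)] at h1
    exact h1.trans (exp_le_exp.2 (mul_le_mul_of_nonneg_left ht.2 hc0))
  have h1 : 1 ≤ exp (S.impulse t y / μ) :=
    one_le_exp (div_nonneg (S.impulse_nonneg hR ht.1 y) hμ.le)
  have hv := S.v_pos t y
  calc (1 : ℝ) ≤ D * S.v t y * G t := h1.trans (hFG t ht y hy)
    _ ≤ D * S.v t y * exp (c * T) := mul_le_mul_of_nonneg_left hGT (by positivity)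
    _ = _ := by ring

end Sol

end RadHydro

namespace RadHydro

namespace Sol

variable {μ R a b κ₁ κ₂ β γ T : ℝ} (S : Sol μ R a b κ₁ κ₂ β γ T)

lemma jointSmooth_dissipation : JointSmooth fun s x => (px S.u s x) ^ 2 / S.v s x :=
  ((JointSmooth.px S.smooth_u).pow 2).div S.smooth_v fun p => (S.v_pos p.1 p.2).ne'

lemma jointSmooth_sq_div : JointSmooth fun s x => (S.θ s x) ^ 2 / S.v s x :=
  (S.smooth_θ.pow 2).div S.smooth_v fun p => (S.v_pos p.1 p.2).ne'

/-- The kinetic energy inequality. -/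
lemma L2sq_u_add_dissipation_le (hμ : 0 < μ) {W t : ℝ} (ht : t ∈ Icc (0 : ℝ) T)
    (hW : ∀ s ∈ Icc (0 : ℝ) t, tInt (fun x => (S.θ s x) ^ 2 / S.v s x) ≤ W) :
    L2sq (S.u t) + μ * (∫ s in (0 : ℝ)..t, tInt fun x => (px S.u s x) ^ 2 / S.v s x)
      ≤ L2sq (S.u 0) + R ^ 2 / μ * W * t := by
  have hu : JointSmooth S.u := S.smooth_u
  have hu2 : JointSmooth fun s x => (S.u s x) ^ 2 := hu.pow 2
  have hφ : JointSmooth fun s x => S.u s x * (S.viscous s x - S.pressure s x) :=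
    hu.mul (S.jointSmooth_viscous.sub S.jointSmooth_pressure)
  have hD := S.jointSmooth_dissipation
  have hDc : Continuous fun s => tInt fun x => (px S.u s x) ^ 2 / S.v s x :=
    continuous_iff_continuousAt.2 fun s => (hD.hasDerivAt_tInt s).continuousAt
  have hder : ∀ s ∈ Icc (0 : ℝ) t, HasDerivAt
      (fun s => L2sq (S.u s)
        + μ * (∫ r in (0 : ℝ)..s, tInt fun x => (px S.u r x) ^ 2 / S.v r x)
        - R ^ 2 / μ * W * s)
      (tInt (pt (fun s x => (S.u s x) ^ 2) s)
        + μ * (tInt fun x => (px S.u s x) ^ 2 / S.v s x) - R ^ 2 / μ * W * 1) s := fun s _ =>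
    ((hu2.hasDerivAt_tInt s).add
      ((hDc.integral_hasStrictDerivAt 0 s).hasDerivAt.const_mul μ)).sub
      ((hasDerivAt_id s).const_mul _)
  have h := le_initial_of_hasDerivAt_nonpos hder (fun s hs => ?_) ⟨ht.1, le_rfl⟩
  · simp only [intervalIntegral.integral_same] at h
    linarith
  · have hsT : s ∈ Icc (0 : ℝ) T := ⟨hs.1, hs.2.trans ht.2⟩
    have cpt := continuous_slice hu2.pt.continuous s
    have cD : Continuous fun x => (px S.u s x) ^ 2 / S.v s x :=
      hD.continuous.comp (continuous_const.prodMk continuous_id)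
    have cφ := continuous_slice hφ.px.continuous s
    have cθ : Continuous fun x => (S.θ s x) ^ 2 / S.v s x :=
      S.jointSmooth_sq_div.continuous.comp (continuous_const.prodMk continuous_id)
    have key : tInt (fun x => 1 * pt (fun s x => (S.u s x) ^ 2) s x
          + μ * ((px S.u s x) ^ 2 / S.v s x))
        ≤ tInt (fun x => 2 * px (fun s x => S.u s x * (S.viscous s x - S.pressure s x)) s x
          + R ^ 2 / μ * ((S.θ s x) ^ 2 / S.v s x)) := by
      refine tInt_mono ((continuous_const.mul cpt).add (continuous_const.mul cD))
        ((continuous_const.mul cφ).add (continuous_const.mul cθ)) fun x _ => ?_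
      have e1 : pt (fun s x => (S.u s x) ^ 2) s x = 2 * S.u s x * pt S.u s x := by
        have := (hu.hasDerivAt_time s x).pow 2
        simpa using (hu2.hasDerivAt_time s x).unique this
      have e2 : px (fun s x => S.u s x * (S.viscous s x - S.pressure s x)) s x
          = px S.u s x * (S.viscous s x - S.pressure s x)
            + S.u s x * (px S.viscous s x - px S.pressure s x) :=
        (hφ.hasDerivAt_space s x).unique ((hu.hasDerivAt_space s x).mul
          ((S.jointSmooth_viscous.hasDerivAt_space s x).sub
            (S.jointSmooth_pressure.hasDerivAt_space s x)))
      have e3 : pt S.u s x = px S.viscous s x - px S.pressure s x := by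
        have := S.eq_mom s hsT x
        linarith
      have hv := S.v_pos s x
      have e4 : 2 * (px S.u s x * (S.viscous s x - S.pressure s x))
          + R ^ 2 / μ * ((S.θ s x) ^ 2 / S.v s x) - μ * ((px S.u s x) ^ 2 / S.v s x)
          = (μ * px S.u s x - R * S.θ s x) ^ 2 / (μ * S.v s x) := by
        simp only [viscous, pressure]
        field_simp
        ring
      have e5 : 0 ≤ (μ * px S.u s x - R * S.θ s x) ^ 2 / (μ * S.v s x) := by positivity
      rw [e1, e2, e3]
      linarith
    rw [tInt_linear_combination cpt cD, tInt_linear_combination cφ cθ, hφ.tInt_px_eq_zero] at key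
    · have h1 : R ^ 2 / μ * tInt (fun x => (S.θ s x) ^ 2 / S.v s x) ≤ R ^ 2 / μ * W :=
        mul_le_mul_of_nonneg_left (hW s hs) (by positivity)
      linarith
    · intro x
      simp only [S.periodic_u s x, S.periodic_viscous s x, S.periodic_pressure s x]

/-- Pointwise control of the temperature by its mean and the conductive energy. -/
lemma θ_le (hκ₁ : 0 < κ₁) (hκ₂ : 0 < κ₂) (hβ : 0 < β) {K Y s : ℝ} (hY : 0 ≤ Y)
    (hK : tInt (S.θ s) ≤ K)
    (hYs : tInt (fun x => (kappa κ₁ κ₂ β (S.v s x) (S.θ s x)) ^ 2 * (px S.θ s x) ^ 2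
      / (S.v s x) ^ 2) ≤ Y)
    {x : ℝ} (hx : x ∈ Icc (-(1/2) : ℝ) (1/2)) :
    S.θ s x ≤ (K ^ (β + 3 / 2) + (β + 3 / 2) / 2 * (K + 1 / κ₂ ^ 2)) ^ (1 / (β + 3 / 2))
      * (1 + Y ^ (1 / (2 * β + 3))) := by
  have hθ : JointSmooth S.θ := S.smooth_θ
  have hK0 : 0 ≤ K := (tInt_nonneg fun x => (S.θ_pos s x).le).trans hK
  obtain ⟨p, hp⟩ : ∃ p, p = β + 3 / 2 := ⟨_, rfl⟩
  have hp0 : 0 < p := by linarith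
  rw [← hp]
  set l : ℝ := √(1 + Y) with hl
  have hl2 : l ^ 2 = 1 + Y := sq_sqrt (by linarith)
  have hl1 : 1 ≤ l := one_le_sqrt.2 (by linarith)
  have hl0 : 0 < l := by linarith
  have cθ : Continuous (S.θ s) := continuous_slice hθ.continuous s
  have hq : JointSmooth fun s x => (kappa κ₁ κ₂ β (S.v s x) (S.θ s x)) ^ 2 * (px S.θ s x) ^ 2
      / (S.v s x) ^ 2 :=
    ((S.jointSmooth_kappa.pow 2).mul (hθ.px.pow 2)).div (S.smooth_v.pow 2)
      fun z => (pow_pos (S.v_pos z.1 z.2) 2).ne'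
  have cq : Continuous fun x => (kappa κ₁ κ₂ β (S.v s x) (S.θ s x)) ^ 2 * (px S.θ s x) ^ 2
      / (S.v s x) ^ 2 :=
    hq.continuous.comp (continuous_const.prodMk continuous_id)
  have hder : ∀ z, HasDerivAt (fun z => S.θ s z ^ p) (px S.θ s z * p * S.θ s z ^ (p - 1)) z :=
    fun z => (hθ.hasDerivAt_space s z).rpow_const (Or.inl (S.θ_pos s z).ne')
  have cder : Continuous fun z => px S.θ s z * p * S.θ s z ^ (p - 1) :=
    ((continuous_slice hθ.px.continuous s).mul continuous_const).mul
      (cθ.rpow_const fun z => Or.inl (S.θ_pos s z).ne')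
  have hvar : tInt (fun z => |px S.θ s z * p * S.θ s z ^ (p - 1)|)
      ≤ p / 2 * (K + 1 / κ₂ ^ 2) * l := by
    have h1 := tInt_mono (g := fun z => p / 2 * l * S.θ s z + p / (2 * l * κ₂ ^ 2)
        * ((kappa κ₁ κ₂ β (S.v s z) (S.θ s z)) ^ 2 * (px S.θ s z) ^ 2 / (S.v s z) ^ 2))
      cder.abs ((continuous_const.mul cθ).add (continuous_const.mul cq)) fun z _ => by
        have hv := S.v_pos s z
        have hθz := S.θ_pos s z
        have hpow : S.θ s z ^ (p - 1) = S.θ s z ^ β * √(S.θ s z) := by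
          rw [sqrt_eq_rpow, ← rpow_add hθz]
          congr 1
          linarith
        set A := √(S.θ s z) with hA
        set B := S.θ s z ^ β with hB
        have hB0 : 0 < B := rpow_pos_of_pos hθz β
        have hA2 : A ^ 2 = S.θ s z := sq_sqrt hθz.le
        have hA0 : 0 ≤ A := sqrt_nonneg _
        have hk : κ₂ ^ 2 * (B * |px S.θ s z|) ^ 2
            ≤ (kappa κ₁ κ₂ β (S.v s z) (S.θ s z)) ^ 2 * (px S.θ s z) ^ 2 / (S.v s z) ^ 2 := by
          have h2 : κ₂ * S.v s z * B ≤ kappa κ₁ κ₂ β (S.v s z) (S.θ s z) := by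
            simp only [kappa, ← hB]
            linarith
          have h3 : (κ₂ * S.v s z * B) ^ 2 ≤ (kappa κ₁ κ₂ β (S.v s z) (S.θ s z)) ^ 2 :=
            pow_le_pow_left₀ (by positivity) h2 2
          rw [le_div_iff₀ (by positivity), mul_pow B, sq_abs]
          nlinarith [mul_le_mul_of_nonneg_right h3 (sq_nonneg (px S.θ s z))]
        have hyoung : A * (B * |px S.θ s z|)
            ≤ l / 2 * A ^ 2 + 1 / (2 * l) * (B * |px S.θ s z|) ^ 2 := by
          have e : l / 2 * A ^ 2 + 1 / (2 * l) * (B * |px S.θ s z|) ^ 2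
              - A * (B * |px S.θ s z|) = (l * A - B * |px S.θ s z|) ^ 2 / (2 * l) := by
            field_simp
            ring
          have : 0 ≤ (l * A - B * |px S.θ s z|) ^ 2 / (2 * l) := by positivity
          linarith
        calc |px S.θ s z * p * S.θ s z ^ (p - 1)|
            = p * (A * (B * |px S.θ s z|)) := by
              rw [hpow, abs_mul, abs_mul, abs_of_pos hp0,
                abs_of_nonneg (a := B * A) (mul_nonneg hB0.le hA0)]
              ring
          _ ≤ p * (l / 2 * A ^ 2 + 1 / (2 * l) * (B * |px S.θ s z|) ^ 2) :=
              mul_le_mul_of_nonneg_left hyoung hp0.le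
          _ = p / 2 * l * S.θ s z
              + p / (2 * l * κ₂ ^ 2) * (κ₂ ^ 2 * (B * |px S.θ s z|) ^ 2) := by
              rw [hA2]
              field_simp
          _ ≤ _ := by gcongr
    rw [tInt_linear_combination cθ cq] at h1
    have h2 : p / 2 * l * tInt (S.θ s) ≤ p / 2 * l * K := by gcongr
    have h3 := mul_le_mul_of_nonneg_left (hYs.trans (by linarith : Y ≤ l ^ 2))
      (by positivity : 0 ≤ p / (2 * l * κ₂ ^ 2))
    have h4 : p / (2 * l * κ₂ ^ 2) * l ^ 2 = p / 2 * (1 / κ₂ ^ 2) * l := by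
      field_simp
    linarith
  obtain ⟨y, hy, hmean⟩ := exists_le_tInt cθ
  have h1 := sub_le_tInt_abs_deriv hder cder hx hy
  have h2 : S.θ s y ^ p ≤ K ^ p := rpow_le_rpow (S.θ_pos s y).le (hmean.trans hK) hp0.le
  have hKp : 0 ≤ K ^ p := rpow_nonneg hK0 p
  have h3 : S.θ s x ^ p ≤ (K ^ p + p / 2 * (K + 1 / κ₂ ^ 2)) * l := by
    nlinarith
  have hc0 : 0 ≤ K ^ p + p / 2 * (K + 1 / κ₂ ^ 2) := by positivity
  have h4 := rpow_le_rpow (rpow_nonneg (S.θ_pos s x).le p) h3 (by positivity : 0 ≤ 1 / p)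
  rw [← rpow_mul (S.θ_pos s x).le, mul_one_div_cancel hp0.ne', rpow_one,
    mul_rpow hc0 hl0.le] at h4
  refine h4.trans (mul_le_mul_of_nonneg_left ?_ (rpow_nonneg hc0 _))
  have e : l ^ (1 / p) = (1 + Y) ^ (1 / (2 * β + 3)) := by
    rw [hl, sqrt_eq_rpow, ← rpow_mul (by linarith)]
    congr 1
    rw [hp]
    field_simp
  rw [e]
  have h5 := rpow_add_le_add_rpow zero_le_one hY
    (by positivity : 0 ≤ 1 / (2 * β + 3)) ((div_le_one (by positivity)).2 (by linarith))
  rwa [one_rpow] at h5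

lemma conductive_le_Y {s t : ℝ} (hs : s ∈ Icc (0 : ℝ) t) :
    tInt (fun x => (kappa κ₁ κ₂ β (S.v s x) (S.θ s x)) ^ 2 * (px S.θ s x) ^ 2
      / (S.v s x) ^ 2) ≤ S.Y t := by
  have hq : JointSmooth fun s x => (kappa κ₁ κ₂ β (S.v s x) (S.θ s x)) ^ 2 * (px S.θ s x) ^ 2
      / (S.v s x) ^ 2 :=
    ((S.jointSmooth_kappa.pow 2).mul ((JointSmooth.px S.smooth_θ).pow 2)).div (S.smooth_v.pow 2)
      fun z => (pow_pos (S.v_pos z.1 z.2) 2).ne'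
  have hc : Continuous fun s => tInt fun x =>
      (kappa κ₁ κ₂ β (S.v s x) (S.θ s x)) ^ 2 * (px S.θ s x) ^ 2 / (S.v s x) ^ 2 :=
    continuous_iff_continuousAt.2 fun s => (hq.hasDerivAt_tInt s).continuousAt
  exact le_csSup (isCompact_Icc.image hc).bddAbove (mem_image_of_mem _ hs)

end Sol

lemma L2sq_nonneg (f : ℝ → ℝ) : 0 ≤ L2sq f := tInt_nonneg fun x => sq_nonneg (f x)

lemma H2sq_nonneg (f : ℝ → ℝ) : 0 ≤ H2sq f :=
  add_nonneg (add_nonneg (L2sq_nonneg _) (L2sq_nonneg _)) (L2sq_nonneg _)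

lemma L2sq_le_H2sq (f : ℝ → ℝ) : L2sq f ≤ H2sq f := by
  have := L2sq_nonneg (deriv f)
  have := L2sq_nonneg (deriv (deriv f))
  simp only [H2sq]
  linarith

lemma L2sq_deriv_le_H2sq (f : ℝ → ℝ) : L2sq (deriv f) ≤ H2sq f := by
  have := L2sq_nonneg f
  have := L2sq_nonneg (deriv (deriv f))
  simp only [H2sq]
  linarith

lemma DataBounded.H2sq_le {M ε : ℝ} {v₀ u₀ θ₀ : ℝ → ℝ} (h : DataBounded M ε v₀ u₀ θ₀) :
    H2sq v₀ ≤ M ^ 2 ∧ H2sq u₀ ≤ M ^ 2 ∧ H2sq θ₀ ≤ M ^ 2 := by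
  have h1 := (sqrt_le_iff.1 h.1).2
  have hv := H2sq_nonneg v₀
  have hu := H2sq_nonneg u₀
  have hθ := H2sq_nonneg θ₀
  exact ⟨by linarith, by linarith, by linarith⟩

end RadHydro

theorem stmt_7 (μ R a b κ₁ κ₂ β γ : ℝ)
    (hμ : 0 < μ) (hR : 0 < R) (ha : 0 < a) (hb : 0 < b)
    (hκ₁ : 0 < κ₁) (hκ₂ : 0 < κ₂) (hβ : 0 < β) (hγ : 1 < γ)
    (T M ε : ℝ) (hT : 0 < T) (hM : 1 ≤ M) (hε0 : 0 < ε) (hε1 : ε ≤ 1) :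
    ∃ C : ℝ, 0 < C ∧
      ∀ S : Sol μ R a b κ₁ κ₂ β γ T, S.Bounded M ε →
        ∀ t ∈ Icc (0 : ℝ) T,
          L2sq (S.u t) + (∫ s in (0 : ℝ)..t, tInt fun x => (px S.u s x) ^ 2 / S.v s x)
            ≤ C * (1 + S.Y t ^ (1 / (2 * β + 3))) := by
  obtain ⟨c, hc⟩ : ∃ c, c = R / (γ - 1) := ⟨_, rfl⟩
  have hc0 : 0 < c := hc ▸ div_pos hR (by linarith)
  obtain ⟨E, hE⟩ : ∃ E, E = c * (1 + M ^ 2) + M ^ 2 / 2 := ⟨_, rfl⟩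
  have hE0 : 0 < E := by rw [hE]; positivity
  obtain ⟨K, hK⟩ : ∃ K, K = E / c := ⟨_, rfl⟩
  have hK0 : 0 < K := hK ▸ div_pos hE0 hc0
  obtain ⟨D, hD⟩ : ∃ D, D = exp (2 * (1 + 2 * E) / μ) * ((2 + M ^ 2) / ε) := ⟨_, rfl⟩
  have hD0 : 0 < D := by rw [hD]; positivity
  obtain ⟨L, hL⟩ : ∃ L, L = D * exp (R / μ * D * K * T) := ⟨_, rfl⟩
  have hL0 : 0 < L := by rw [hL]; positivity
  obtain ⟨Θ, hΘ⟩ : ∃ Θ, Θ = (K ^ (β + 3 / 2) + (β + 3 / 2) / 2 * (K + 1 / κ₂ ^ 2))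
    ^ (1 / (β + 3 / 2)) := ⟨_, rfl⟩
  have hΘ0 : 0 < Θ := by rw [hΘ]; positivity
  obtain ⟨Q, hQ⟩ : ∃ Q, Q = M ^ 2 + R ^ 2 / μ * (L * Θ * K) * T := ⟨_, rfl⟩
  have hQ0 : 0 < Q := by rw [hQ]; positivity
  refine ⟨Q + Q / μ, by positivity, fun S hS t ht => ?_⟩
  obtain ⟨hv₀, hu₀, hθ₀⟩ := DataBounded.H2sq_le hS
  have cv : ∀ s, Continuous (S.v s) := continuous_slice S.smooth_v.continuous
  have cu : ∀ s, Continuous (S.u s) := continuous_slice S.smooth_u.continuous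
  have cθ : ∀ s, Continuous (S.θ s) := continuous_slice S.smooth_θ.continuous
  have henergy : ∀ s ∈ Icc (0 : ℝ) T, c * tInt (S.θ s) + 1 / 2 * L2sq (S.u s) ≤ E := by
    have e : ∀ s, tInt (fun x => R / (γ - 1) * S.θ s x + (S.u s x) ^ 2 / 2)
        = c * tInt (S.θ s) + 1 / 2 * L2sq (S.u s) := fun s => by
      rw [L2sq, ← tInt_linear_combination (g := fun x => (S.u s x) ^ 2) (cθ s) ((cu s).pow 2), hc]
      congr 1
      funext x
      ring
    intro s hs
    rw [← e s, S.tInt_energy hs, e 0, hE]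
    have h1 : tInt (S.θ 0) ≤ 1 + M ^ 2 := by
      have h := tInt_abs_le_one_add_L2sq (cθ 0)
      simp only [abs_of_pos (S.θ_pos 0 _)] at h
      linarith [L2sq_le_H2sq (S.θ 0)]
    have h2 := L2sq_le_H2sq (S.u 0)
    nlinarith [mul_le_mul_of_nonneg_left h1 hc0.le]
  have hθK : ∀ s ∈ Icc (0 : ℝ) T, tInt (S.θ s) ≤ K := fun s hs => by
    rw [hK, le_div_iff₀ hc0]
    linarith [henergy s hs, L2sq_nonneg (S.u s)]
  have huU : ∀ s ∈ Icc (0 : ℝ) T, tInt (fun x => |S.u s x|) ≤ 1 + 2 * E := fun s hs => by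
    have h1 := tInt_abs_le_one_add_L2sq (cu s)
    have h2 : 0 ≤ c * tInt (S.θ s) :=
      mul_nonneg hc0.le (tInt_nonneg fun x => (S.θ_pos s x).le)
    linarith [henergy s hs]
  have hvN : ∀ x ∈ Icc (-(1/2) : ℝ) (1/2), S.v 0 x ≤ 2 + M ^ 2 := fun x hx => by
    obtain ⟨y, hy, hmean⟩ := exists_le_tInt (cv 0)
    rw [S.mean_v] at hmean
    have cpx : Continuous (deriv (S.v 0)) :=
      continuous_slice (JointSmooth.px S.smooth_v).continuous 0
    have h1 := sub_le_tInt_abs_deriv (JointSmooth.hasDerivAt_space S.smooth_v 0) cpx hx hy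
    have h2 := tInt_abs_le_one_add_L2sq cpx
    have h3 := L2sq_deriv_le_H2sq (S.v 0)
    simp only [px] at h1
    linarith
  have hvL : ∀ s ∈ Icc (0 : ℝ) T, ∀ x ∈ Icc (-(1/2) : ℝ) (1/2), 1 ≤ L * S.v s x :=
    fun s hs x hx => by
      rw [hL]
      refine S.le_v hμ hR hD0 (fun r hr y hy z hz => ?_) hθK hs hx
      rw [hD]
      exact S.v_mul_exp_impulse_le hμ hε0 hS.2.1 hvN huU hr hy hz
  have hY0 : 0 ≤ S.Y t :=
    (tInt_nonneg fun x => by positivity).trans (S.conductive_le_Y ⟨le_rfl, ht.1⟩)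
  set Z : ℝ := 1 + S.Y t ^ (1 / (2 * β + 3)) with hZ
  have hZ1 : 1 ≤ Z := by
    have := rpow_nonneg hY0 (1 / (2 * β + 3))
    linarith
  have hW : ∀ s ∈ Icc (0 : ℝ) t,
      tInt (fun x => (S.θ s x) ^ 2 / S.v s x) ≤ L * (Θ * Z) * K := fun s hs => by
    have hsT : s ∈ Icc (0 : ℝ) T := ⟨hs.1, hs.2.trans ht.2⟩
    have h1 := tInt_mono (f := fun x => (S.θ s x) ^ 2 / S.v s x)
      (g := fun x => L * (Θ * Z) * S.θ s x)
      (S.jointSmooth_sq_div.continuous.comp (continuous_const.prodMk continuous_id)) (continuous_const.mul (cθ s))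
      fun x hx => by
        have hθx := S.θ_pos s x
        have hmax : S.θ s x ≤ Θ * Z := by
          rw [hΘ]
          exact S.θ_le hκ₁ hκ₂ hβ hY0 (hθK s hsT) (S.conductive_le_Y hs) hx
        rw [div_le_iff₀ (S.v_pos s x)]
        calc (S.θ s x) ^ 2 = 1 * (S.θ s x * S.θ s x) := by ring
          _ ≤ L * S.v s x * (Θ * Z * S.θ s x) :=
            mul_le_mul (hvL s hsT x hx) (mul_le_mul_of_nonneg_right hmax hθx.le)
              (by positivity) (mul_nonneg hL0.le (S.v_pos s x).le)
          _ = _ := by ring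
    rw [tInt_const_mul] at h1
    exact h1.trans (mul_le_mul_of_nonneg_left (hθK s hsT) (by positivity))
  have hmain := S.L2sq_u_add_dissipation_le hμ ht hW
  set I : ℝ := ∫ s in (0 : ℝ)..t, tInt fun x => (px S.u s x) ^ 2 / S.v s x with hI
  have hI0 : 0 ≤ I := intervalIntegral.integral_nonneg ht.1 fun s _ =>
    tInt_nonneg fun x => div_nonneg (sq_nonneg _) (S.v_pos s x).le
  have hQZ : L2sq (S.u t) + μ * I ≤ Q * Z := by
    refine hmain.trans ?_
    have h1 : R ^ 2 / μ * (L * (Θ * Z) * K) * t ≤ R ^ 2 / μ * (L * (Θ * Z) * K) * T :=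
      mul_le_mul_of_nonneg_left ht.2 (by positivity)
    have h2 : M ^ 2 ≤ M ^ 2 * Z := le_mul_of_one_le_right (by positivity) hZ1
    have h3 := L2sq_le_H2sq (S.u 0)
    rw [hQ]
    linarith
  have h1 : L2sq (S.u t) ≤ Q * Z := by nlinarith
  have h2 : I ≤ Q / μ * Z := by
    rw [div_mul_eq_mul_div, le_div_iff₀ hμ]
    linarith [L2sq_nonneg (S.u t)]
  linarith
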